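/- arXiv:0707.1505 — 2 statements merged into one kernel-verified Lean document; each statement's English description precedes it below -/
import Mathlib

section
/- For every real λ ≥ 1 there is a constant C > 0 (depending on K, N, F₀,…,F_N, α, and λ) such that for all real s > 0: Σ over good prime ideals 𝔭 of 𝓞_K of (log N𝔭)/(N𝔭·exp(s·m_𝔭(φ,P)^λ)) ≤ C·s^{−1/λ}. -/
open MvPolynomial NumberField Filter Topology

noncomputable section

/-- The map on integral vectors induced by the homogeneous polynomials `Fp i`. -/
def FmapK (K : Type) [Field K] [NumberField K] {N : ℕ}
    (Fp : Fin (N + 1) → MvPolynomial (Fin (N + 1)) (𝓞 K)) :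
    (Fin (N + 1) → 𝓞 K) → (Fin (N + 1) → 𝓞 K) :=
  fun b i => MvPolynomial.eval b (Fp i)

/-- A nonzero prime ideal `p` of `𝓞 K` is good (for `Fp` and `α`) if `p` does not contain the
ideal generated by the coordinates of `α`, and the reductions of the `Fp i` modulo `p` have no
common zero in an algebraic closure of the residue field `𝓞 K ⧸ p` other than the origin. -/
def GoodIdeal (K : Type) [Field K] [NumberField K] {N : ℕ}
    (Fp : Fin (N + 1) → MvPolynomial (Fin (N + 1)) (𝓞 K))
    (α : Fin (N + 1) → 𝓞 K) (p : Ideal (𝓞 K)) : Prop :=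
  p.IsPrime ∧ p ≠ ⊥ ∧ ¬ (Ideal.span (Set.range α) ≤ p) ∧
  ∃ hm : p.IsMaximal,
    letI : Field ((𝓞 K) ⧸ p) := @Ideal.Quotient.field _ _ p hm
    ∀ x : Fin (N + 1) → AlgebraicClosure ((𝓞 K) ⧸ p),
      (∀ i, MvPolynomial.aeval x ((Fp i).map (Ideal.Quotient.mk p)) = 0) → x = 0

/-- The number of distinct points of `ℙ^N(𝔽_p)` represented by the reductions mod `p` of the
iterates `F^[n](α)`, i.e. the size of the orbit of `P mod p`. -/
def orbitLenK (K : Type) [Field K] [NumberField K] {N : ℕ}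
    (Fp : Fin (N + 1) → MvPolynomial (Fin (N + 1)) (𝓞 K))
    (α : Fin (N + 1) → 𝓞 K) (p : Ideal (𝓞 K)) : ℕ :=
  Set.ncard (Set.range fun n : ℕ =>
    Quotient.mk (MulAction.orbitRel ((𝓞 K) ⧸ p)ˣ (Fin (N + 1) → (𝓞 K) ⧸ p))
      (fun i => Ideal.Quotient.mk p (((FmapK K Fp)^[n] α) i)))

lemma aux_prod_le (K : Type) [Field K] [NumberField K] (T : Finset (Ideal (𝓞 K)))
    (hT : ∀ p ∈ T, p.IsPrime ∧ p ≠ ⊥) (D : 𝓞 K) (hD : D ≠ 0) (hm : ∀ p ∈ T, D ∈ p) :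
    ∑ p ∈ T, Real.log (Ideal.absNorm p) ≤ Real.log (Ideal.absNorm (Ideal.span {D})) := by
  have h1 : ∏ p ∈ T, p ∣ Ideal.span {D} := by
    apply Finset.prod_primes_dvd
    · intro p hp
      exact Ideal.prime_of_isPrime (hT p hp).2 (hT p hp).1
    · intro p hp
      exact Ideal.dvd_span_singleton.2 (hm p hp)
  have h2 : ∏ p ∈ T, Ideal.absNorm p ∣ Ideal.absNorm (Ideal.span {D}) := by
    rw [← map_prod]
    exact map_dvd _ h1
  have h3 : Ideal.absNorm (Ideal.span {D}) ≠ 0 := by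
    simpa [Ideal.absNorm_eq_zero_iff] using hD
  have h4 := Nat.le_of_dvd (Nat.pos_of_ne_zero h3) h2
  have hne : ∀ p ∈ T, (Ideal.absNorm p : ℝ) ≠ 0 := by
    intro p hp
    simpa [Ideal.absNorm_eq_zero_iff] using (hT p hp).2
  rw [← Real.log_prod hne]
  apply Real.log_le_log
  · apply Finset.prod_pos
    intro p hp
    exact lt_of_le_of_ne (by positivity) (hne p hp).symm
  · exact_mod_cast h4

lemma aux_two_le (K : Type) [Field K] [NumberField K] (p : Ideal (𝓞 K))
    (hp : p.IsPrime ∧ p ≠ ⊥) : 2 ≤ Ideal.absNorm p := by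
  have h0 : Ideal.absNorm p ≠ 0 := by simpa [Ideal.absNorm_eq_zero_iff] using hp.2
  have h1 : Ideal.absNorm p ≠ 1 := Ideal.absNorm_eq_one_iff.not.mpr hp.1.ne_top
  omega

lemma aux_mem_prime (K : Type) [Field K] [NumberField K] (p : Ideal (𝓞 K))
    (hp : p.IsPrime) (n : ℕ) : n ≠ 0 → (n : 𝓞 K) ∈ p → ∃ q, q.Prime ∧ q ∣ n ∧ (q : 𝓞 K) ∈ p := by
  induction n using Nat.recOnMul with
  | zero => intro h; exact absurd rfl h
  | one => intro _ h; exact absurd ((Ideal.eq_top_iff_one p).2 (by simpa using h)) hp.ne_top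
  | prime q hq => intro _ h; exact ⟨q, hq, dvd_rfl, h⟩
  | mul a b ha hb =>
    intro h0 h
    push_cast at h
    rcases hp.mem_or_mem h with h | h
    · obtain ⟨q, h1, h2, h3⟩ := ha (by rintro rfl; simp at h0) h
      exact ⟨q, h1, h2.mul_right _, h3⟩
    · obtain ⟨q, h1, h2, h3⟩ := hb (by rintro rfl; simp at h0) h
      exact ⟨q, h1, h2.mul_left _, h3⟩

lemma aux_primorial_mem (K : Type) [Field K] [NumberField K] (p : Ideal (𝓞 K))
    (hp : p.IsPrime ∧ p ≠ ⊥) (n : ℕ) (hn : Ideal.absNorm p ≤ n) :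
    ((primorial n : ℕ) : 𝓞 K) ∈ p := by
  have h2 := aux_two_le K p hp
  obtain ⟨q, h1, h2, h3⟩ := aux_mem_prime K p hp.1 (Ideal.absNorm p) (by omega)
    (Ideal.absNorm_mem p)
  have h4 : q ≤ n := (Nat.le_of_dvd (by omega) h2).trans hn
  have h5 : q ∣ primorial n := by
    unfold primorial
    apply Finset.dvd_prod_of_mem (fun x => x)
    simp [h1]; omega
  obtain ⟨c, hc⟩ := h5
  rw [hc]
  push_cast
  exact Ideal.mul_mem_right _ _ h3

lemma aux_dyadic (K : Type) [Field K] [NumberField K] (T : Finset (Ideal (𝓞 K)))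
    (hT : ∀ p ∈ T, p.IsPrime ∧ p ≠ ⊥) (k : ℕ)
    (hk : ∀ p ∈ T, 2 ^ k ≤ Ideal.absNorm p ∧ Ideal.absNorm p ≤ 2 ^ (k + 1)) :
    ∑ p ∈ T, Real.log (Ideal.absNorm p) / (Ideal.absNorm p : ℝ)
      ≤ 2 * Module.finrank ℤ (𝓞 K) * Real.log 4 := by
  have hP : ((primorial (2 ^ (k+1)) : ℕ) : 𝓞 K) ≠ 0 := by
    exact_mod_cast (primorial_pos _).ne'
  have h1 := aux_prod_le K T hT _ hP (fun p hp => aux_primorial_mem K p (hT p hp) _ (hk p hp).2)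
  have h2 : Ideal.absNorm (Ideal.span {((primorial (2 ^ (k+1)) : ℕ) : 𝓞 K)})
      = (primorial (2 ^ (k+1))) ^ Module.finrank ℤ (𝓞 K) := by
    rw [Ideal.absNorm_span_singleton]
    have := Algebra.norm_algebraMap (S := 𝓞 K) ((primorial (2 ^ (k+1)) : ℕ) : ℤ)
    simp only [algebraMap_int_eq, eq_intCast, Int.cast_natCast] at this
    rw [this, Int.natAbs_pow, Int.natAbs_natCast]
  rw [h2] at h1
  push_cast at h1
  rw [Real.log_pow] at h1
  have h3 : Real.log (primorial (2 ^ (k+1))) ≤ 2 ^ (k+1) * Real.log 4 := by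
    have : (primorial (2 ^ (k+1)) : ℝ) ≤ (4:ℝ) ^ (2 ^ (k+1)) := by
      exact_mod_cast primorial_le_four_pow _
    have h := Real.log_le_log (by exact_mod_cast primorial_pos _) this
    rw [Real.log_pow] at h
    exact_mod_cast h
  calc _ ≤ ∑ p ∈ T, Real.log (Ideal.absNorm p) / (2:ℝ)^k := by
        apply Finset.sum_le_sum
        intro p hp
        have := (hk p hp).1
        have h5 : (2:ℝ)^k ≤ Ideal.absNorm p := by exact_mod_cast this
        apply div_le_div_of_nonneg_left _ (by positivity) h5
        exact Real.log_natCast_nonneg _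
    _ = (∑ p ∈ T, Real.log (Ideal.absNorm p)) / (2:ℝ)^k := by rw [Finset.sum_div]
    _ ≤ _ := by
        rw [div_le_iff₀ (by positivity)]
        refine h1.trans ?_
        calc _ ≤ (Module.finrank ℤ (𝓞 K) : ℝ) * (2 ^ (k+1) * Real.log 4) := by gcongr
          _ = _ := by ring

lemma aux_small (K : Type) [Field K] [NumberField K] (T : Finset (Ideal (𝓞 K)))
    (hT : ∀ p ∈ T, p.IsPrime ∧ p ≠ ⊥) (J : ℕ)
    (hk : ∀ p ∈ T, Ideal.absNorm p < 2 ^ J) :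
    ∑ p ∈ T, Real.log (Ideal.absNorm p) / (Ideal.absNorm p : ℝ)
      ≤ J * (2 * Module.finrank ℤ (𝓞 K) * Real.log 4) := by
  have hmaps : ∀ p ∈ T, Nat.log 2 (Ideal.absNorm p) ∈ Finset.range J := by
    intro p hp
    have := aux_two_le K p (hT p hp)
    rw [Finset.mem_range]
    exact (Nat.log_lt_iff_lt_pow (by norm_num) (by omega)).2 (hk p hp)
  rw [← Finset.sum_fiberwise_of_maps_to hmaps]
  calc _ ≤ ∑ k ∈ Finset.range J, (2 * Module.finrank ℤ (𝓞 K) * Real.log 4) := by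
        apply Finset.sum_le_sum
        intro k _
        apply aux_dyadic K _ _ k
        · intro p hp
          rw [Finset.mem_filter] at hp
          have := aux_two_le K p (hT p hp.1)
          rw [← hp.2]
          exact ⟨Nat.pow_log_le_self 2 (by omega), (Nat.lt_pow_succ_log_self (by norm_num) _).le⟩
        · intro p hp
          exact hT p (Finset.mem_filter.1 hp).1
    _ = _ := by simp

lemma aux_C (K : Type) [Field K] [NumberField K] (T : Finset (Ideal (𝓞 K)))
    (hT : ∀ p ∈ T, p.IsPrime ∧ p ≠ ⊥) (J : ℕ) (D : 𝓞 K) (hD : D ≠ 0) (hm : ∀ p ∈ T, D ∈ p)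
    (hJ : Real.log (Ideal.absNorm (Ideal.span {D})) ≤ 2 ^ J) :
    ∑ p ∈ T, Real.log (Ideal.absNorm p) / (Ideal.absNorm p : ℝ)
      ≤ J * (2 * Module.finrank ℤ (𝓞 K) * Real.log 4) + 1 := by
  rw [← Finset.sum_filter_add_sum_filter_not T (fun p => Ideal.absNorm p < 2 ^ J)]
  apply add_le_add
  · apply aux_small
    · intro p hp
      exact hT p (Finset.mem_filter.1 hp).1
    · intro p hp
      exact (Finset.mem_filter.1 hp).2
  · have h1 := aux_prod_le K (T.filter (fun p => ¬ Ideal.absNorm p < 2 ^ J))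
      (fun p hp => hT p (Finset.mem_filter.1 hp).1) D hD
      (fun p hp => hm p (Finset.mem_filter.1 hp).1)
    calc _ ≤ ∑ p ∈ T.filter (fun p => ¬ Ideal.absNorm p < 2 ^ J),
          Real.log (Ideal.absNorm p) / (2:ℝ)^J := by
          apply Finset.sum_le_sum
          intro p hp
          have := (Finset.mem_filter.1 hp).2
          have h5 : (2:ℝ)^J ≤ Ideal.absNorm p := by exact_mod_cast not_lt.1 this
          apply div_le_div_of_nonneg_left _ (by positivity) h5
          exact Real.log_natCast_nonneg _
      _ = (∑ p ∈ T.filter (fun p => ¬ Ideal.absNorm p < 2 ^ J),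
          Real.log (Ideal.absNorm p)) / (2:ℝ)^J := by rw [Finset.sum_div]
      _ ≤ 1 := by
        rw [div_le_one (by positivity)]
        exact h1.trans hJ

lemma aux_abel {ι : Type*} (T : Finset ι) (a : ι → ℝ) (m : ι → ℕ) (C : ℝ) (f : ℕ → ℝ)
    (hf : Antitone f) (hf0 : ∀ n, 0 ≤ f n)
    (hS : ∀ k : ℕ, ∑ p ∈ T.filter (fun p => m p ≤ k), a p ≤ C * k) (M : ℕ)
    (hM : ∀ p ∈ T, m p ≤ M) :
    ∑ p ∈ T, a p * f (m p) ≤ C * ∑ k ∈ Finset.range M, f (k + 1) := by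
  have key : ∀ M : ℕ, ∀ j ≤ M, f j = f M + ∑ k ∈ Finset.range M,
      if j ≤ k then (f k - f (k+1)) else 0 := by
    intro M
    induction M with
    | zero => intro j hj; simp at hj; simp [hj]
    | succ M ih =>
      intro j hj
      rw [Finset.sum_range_succ]
      rcases Nat.lt_or_ge M j with h | h
      · have : j = M + 1 := by omega
        subst this
        rw [Finset.sum_eq_zero]
        · simp
        · intro k hk
          rw [Finset.mem_range] at hk
          rw [if_neg (by omega)]
      · rw [if_pos h]
        have := ih j h
        linarith
  have key2 : ∀ M : ℕ, (M : ℝ) * f M + ∑ k ∈ Finset.range M, (k:ℝ) * (f k - f (k+1))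
      = ∑ k ∈ Finset.range M, f (k + 1) := by
    intro M
    induction M with
    | zero => simp
    | succ M ih =>
      rw [Finset.sum_range_succ, Finset.sum_range_succ, ← ih]
      push_cast
      ring
  calc _ = ∑ p ∈ T, (a p * f M + ∑ k ∈ Finset.range M,
        if m p ≤ k then a p * (f k - f (k+1)) else 0) := by
        apply Finset.sum_congr rfl
        intro p hp
        rw [key M (m p) (hM p hp), mul_add, Finset.mul_sum]
        simp
    _ = (∑ p ∈ T.filter (fun p => m p ≤ M), a p) * f M + ∑ k ∈ Finset.range M,
        (∑ p ∈ T.filter (fun p => m p ≤ k), a p) * (f k - f (k+1)) := by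
        rw [Finset.sum_add_distrib, Finset.sum_comm, Finset.filter_true_of_mem hM,
          Finset.sum_mul]
        congr 1
        apply Finset.sum_congr rfl
        intro k _
        rw [Finset.sum_mul, Finset.sum_filter]
    _ ≤ (C * M) * f M + ∑ k ∈ Finset.range M, (C * k) * (f k - f (k+1)) := by
        apply add_le_add
        · exact mul_le_mul_of_nonneg_right (hS M) (hf0 M)
        · apply Finset.sum_le_sum
          intro k _
          exact mul_le_mul_of_nonneg_right (hS k) (sub_nonneg.2 (hf (Nat.le_succ k)))
    _ = _ := by
        rw [← key2, mul_add, Finset.mul_sum]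
        simp only [mul_assoc]

lemma aux_int (l s : ℝ) (hl : 1 ≤ l) (hs : 0 < s) (M : ℕ) :
    ∑ k ∈ Finset.range M, Real.exp (-s * ((k + 1 : ℕ) : ℝ) ^ l) ≤
      s ^ (-1 / l) * Real.Gamma (1 / l + 1) := by
  have hanti : AntitoneOn (fun x : ℝ => Real.exp (-s * x ^ l)) (Set.Icc (0:ℝ) (0 + (M:ℝ))) := by
    intro x hx y hy hxy
    have := Real.rpow_le_rpow hx.1 hxy (by linarith : 0 ≤ l)
    apply Real.exp_le_exp.2
    nlinarith
  have h := hanti.sum_le_integral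
  simp only [zero_add] at h
  refine h.trans ?_
  rw [← integral_exp_neg_mul_rpow (by linarith : 0 < l) hs,
    intervalIntegral.integral_of_le (by positivity)]
  have hi := integrableOn_rpow_mul_exp_neg_mul_rpow (s := 0) (by norm_num)
    (by linarith : 0 < l) hs
  simp only [Real.rpow_zero, one_mul] at hi
  apply MeasureTheory.setIntegral_mono_set hi
  · exact Filter.Eventually.of_forall (fun x => (Real.exp_pos _).le)
  · exact (Set.Ioc_subset_Ioi_self).eventuallyLE

lemma aux_max {ι : Type*} (T : Finset ι) (m : ι → ℕ) : ∃ M, ∀ p ∈ T, m p ≤ M :=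
  ⟨T.sup m, fun _ hp => Finset.le_sup hp⟩

lemma aux_eval_bound (K : Type) [Field K] [NumberField K] {N d : ℕ}
    (P : MvPolynomial (Fin (N + 1)) (𝓞 K)) (hP : P.IsHomogeneous d) (σ : 𝓞 K →+* ℂ)
    (b : Fin (N + 1) → 𝓞 K) (R : ℝ) (hb : ∀ i, ‖σ (b i)‖ ≤ R) :
    ‖σ (MvPolynomial.eval b P)‖ ≤ (∑ e ∈ P.support, ‖σ (P.coeff e)‖) * R ^ d := by
  rw [MvPolynomial.eval_eq', map_sum, Finset.sum_mul]
  refine (norm_sum_le _ _).trans (Finset.sum_le_sum ?_)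
  intro e he
  rw [map_mul, norm_mul]
  apply mul_le_mul_of_nonneg_left _ (norm_nonneg _)
  rw [map_prod, norm_prod]
  have hdeg : ∑ i, e i = d := by
    have := hP.degree_eq_sum_deg_support he
    rw [this]; exact (Finset.sum_subset (Finset.subset_univ _) (by intro i _ hi; simpa using hi)).symm
  calc ∏ i, ‖σ (b i ^ e i)‖ ≤ ∏ i, R ^ e i := by
        apply Finset.prod_le_prod
        · intros; positivity
        · intro i _
          rw [map_pow, norm_pow]
          exact pow_le_pow_left₀ (norm_nonneg _) (hb i) _
    _ = R ^ d := by rw [Finset.prod_pow_eq_pow_sum, hdeg]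

lemma aux_orbit_bound (K : Type) [Field K] [NumberField K] {N d : ℕ}
    (Fp : Fin (N + 1) → MvPolynomial (Fin (N + 1)) (𝓞 K))
    (hhom : ∀ i, (Fp i).IsHomogeneous d) (α : Fin (N + 1) → 𝓞 K) :
    ∃ B : ℝ, 2 ≤ B ∧ ∀ (σ : K →ₐ[ℚ] ℂ) (n : ℕ) (i : Fin (N + 1)),
      ‖σ ((((FmapK K Fp)^[n] α) i : 𝓞 K) : K)‖ ≤ B ^ ((d + 1) ^ n) := by
  set B : ℝ := 2 + (∑ σ : K →ₐ[ℚ] ℂ, ∑ i, ‖σ (α i : K)‖) +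
    ∑ σ : K →ₐ[ℚ] ℂ, ∑ i, ∑ e ∈ (Fp i).support, ‖σ (((Fp i).coeff e : 𝓞 K) : K)‖ with hB
  have hn1 : 0 ≤ ∑ σ : K →ₐ[ℚ] ℂ, ∑ i, ‖σ (α i : K)‖ := by positivity
  have hn2 : 0 ≤ ∑ σ : K →ₐ[ℚ] ℂ, ∑ i, ∑ e ∈ (Fp i).support, ‖σ (((Fp i).coeff e : 𝓞 K) : K)‖ := by
    positivity
  have hB2 : 2 ≤ B := by linarith
  have hBa : ∑ σ : K →ₐ[ℚ] ℂ, ∑ i, ‖σ (α i : K)‖ ≤ B := by linarith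
  have hBb : ∑ σ : K →ₐ[ℚ] ℂ, ∑ i, ∑ e ∈ (Fp i).support, ‖σ (((Fp i).coeff e : 𝓞 K) : K)‖ ≤ B := by
    linarith
  clear_value B
  clear hB hn1 hn2
  refine ⟨B, hB2, ?_⟩
  intro σ n
  induction n with
  | zero =>
    intro i
    have h1 : ‖σ (α i : K)‖ ≤ ∑ i, ‖σ (α i : K)‖ :=
      Finset.single_le_sum (f := fun i => ‖σ (α i : K)‖) (fun _ _ => norm_nonneg _)
        (Finset.mem_univ i)
    have h2 : ∑ i, ‖σ (α i : K)‖ ≤ ∑ σ : K →ₐ[ℚ] ℂ, ∑ i, ‖σ (α i : K)‖ :=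
      Finset.single_le_sum (f := fun σ : K →ₐ[ℚ] ℂ => ∑ i, ‖σ (α i : K)‖)
        (fun _ _ => by positivity) (Finset.mem_univ σ)
    simp only [Function.iterate_zero, id, pow_zero, pow_one]
    exact (h1.trans h2).trans hBa
  | succ n ih =>
    intro i
    rw [Function.iterate_succ_apply']
    have h := aux_eval_bound K (Fp i) (hhom i)
      ((σ : K →+* ℂ).comp (algebraMap (𝓞 K) K)) ((FmapK K Fp)^[n] α) _ ih
    have h1 : ∑ e ∈ (Fp i).support, ‖σ (((Fp i).coeff e : 𝓞 K) : K)‖ ≤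
        ∑ i, ∑ e ∈ (Fp i).support, ‖σ (((Fp i).coeff e : 𝓞 K) : K)‖ :=
      Finset.single_le_sum (f := fun i => ∑ e ∈ (Fp i).support, ‖σ (((Fp i).coeff e : 𝓞 K) : K)‖)
        (fun _ _ => by positivity) (Finset.mem_univ i)
    have h2 : ∑ i, ∑ e ∈ (Fp i).support, ‖σ (((Fp i).coeff e : 𝓞 K) : K)‖ ≤
        ∑ σ : K →ₐ[ℚ] ℂ, ∑ i, ∑ e ∈ (Fp i).support, ‖σ (((Fp i).coeff e : 𝓞 K) : K)‖ :=
      Finset.single_le_sum (f := fun σ : K →ₐ[ℚ] ℂ =>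
        ∑ i, ∑ e ∈ (Fp i).support, ‖σ (((Fp i).coeff e : 𝓞 K) : K)‖)
        (fun _ _ => by positivity) (Finset.mem_univ σ)
    calc _ ≤ _ := h
      _ ≤ B * (B ^ ((d+1)^n)) ^ d := by
          apply mul_le_mul_of_nonneg_right _ (by positivity)
          exact (h1.trans h2).trans hBb
      _ = B ^ (1 + (d+1)^n * d) := by rw [← pow_mul, pow_add, pow_one]
      _ ≤ _ := by
          apply pow_le_pow_right₀ (by linarith)
          rw [pow_succ]
          have : 1 ≤ (d+1)^n := Nat.one_le_pow _ _ (by omega)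
          nlinarith

lemma aux_norm_bound (K : Type) [Field K] [NumberField K] (D : 𝓞 K) (R : ℝ)
    (h : ∀ σ : K →ₐ[ℚ] ℂ, ‖σ (D : K)‖ ≤ R) :
    (Ideal.absNorm (Ideal.span {D}) : ℝ) ≤ R ^ (Fintype.card (K →ₐ[ℚ] ℂ)) := by
  have h1 := Algebra.norm_eq_prod_embeddings ℚ ℂ (D : K)
  have h2 : (Ideal.absNorm (Ideal.span {D}) : ℝ) = ‖algebraMap ℚ ℂ (Algebra.norm ℚ (D : K))‖ := by
    rw [Ideal.absNorm_span_singleton, ← Algebra.coe_norm_int]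
    simp [Nat.cast_natAbs]
  rw [h2, h1, norm_prod]
  calc _ ≤ ∏ σ : K →ₐ[ℚ] ℂ, R := Finset.prod_le_prod (fun _ _ => norm_nonneg _) (fun σ _ => h σ)
    _ = _ := by simp

/-- Primes with small orbit length divide a nonzero element of controlled norm. -/
lemma aux_D (K : Type) [Field K] [NumberField K] {N d : ℕ}
    (Fp : Fin (N + 1) → MvPolynomial (Fin (N + 1)) (𝓞 K))
    (hhom : ∀ i, (Fp i).IsHomogeneous d) (α : Fin (N + 1) → 𝓞 K)
    (horbit : ∀ m n : ℕ, m < n → ∃ i j : Fin (N + 1),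
      ((FmapK K Fp)^[m] α) i * ((FmapK K Fp)^[n] α) j ≠
        ((FmapK K Fp)^[m] α) j * ((FmapK K Fp)^[n] α) i) :
    ∃ c : ℕ, ∀ m : ℕ, 1 ≤ m → ∃ D : 𝓞 K, D ≠ 0 ∧
      Real.log (Ideal.absNorm (Ideal.span {D})) ≤ 2 ^ (c * m) ∧
      ∀ p : Ideal (𝓞 K), p ≠ ⊥ → orbitLenK K Fp α p ≤ m → D ∈ p := by
  obtain ⟨B, hB2, hB⟩ := aux_orbit_bound K Fp hhom α
  have hB1 : 1 ≤ B := by linarith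
  set x : ℕ → Fin (N + 1) → 𝓞 K := fun n => (FmapK K Fp)^[n] α with hx
  have hc : ∀ m n : ℕ, ∃ c : 𝓞 K, c ≠ 0 ∧ (∀ M, m ≤ M → n ≤ M → ∀ σ : K →ₐ[ℚ] ℂ,
      ‖σ (c : K)‖ ≤ B ^ (3 * (d+1)^M)) ∧
      (m < n → ∃ i j, c = x m i * x n j - x m j * x n i) := by
    intro m n
    by_cases hmn : m < n
    · obtain ⟨i, j, hij⟩ := horbit m n hmn
      refine ⟨x m i * x n j - x m j * x n i, sub_ne_zero.2 hij, ?_, fun _ => ⟨i, j, rfl⟩⟩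
      intro M hm hn σ
      have hb : ∀ k ≤ M, ∀ i, ‖σ (x k i : K)‖ ≤ B ^ ((d+1)^M) := fun k hk i =>
        (hB σ k i).trans (pow_le_pow_right₀ hB1 (Nat.pow_le_pow_right (by omega) hk))
      have hE : 1 ≤ (d+1)^M := Nat.one_le_pow _ _ (by omega)
      set E := B ^ ((d+1)^M) with hEdef
      have hE0 : 0 ≤ E := by positivity
      have hE2 : 2 ≤ E := hB2.trans (le_self_pow₀ hB1 (by omega))
      push_cast
      rw [map_sub, map_mul, map_mul]
      calc _ ≤ ‖σ (x m i : K)‖ * ‖σ (x n j : K)‖ + ‖σ (x m j : K)‖ * ‖σ (x n i : K)‖ := by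
            rw [← norm_mul, ← norm_mul]; exact norm_sub_le _ _
        _ ≤ E * E + E * E := by
            gcongr
            · exact hb m hm i
            · exact hb n hn j
            · exact hb m hm j
            · exact hb n hn i
        _ ≤ E ^ 3 := by nlinarith [mul_nonneg hE0 hE0]
        _ = _ := by rw [hEdef, ← pow_mul]; ring_nf
    · refine ⟨1, one_ne_zero, ?_, fun h => absurd h hmn⟩
      intro M _ _ σ
      simpa using one_le_pow₀ hB1
  choose c hc0 hcb hcx using hc
  set n := Fintype.card (K →ₐ[ℚ] ℂ)
  obtain ⟨k, hk⟩ := pow_unbounded_of_one_lt (3 * n * Real.log B) (by norm_num : (1:ℝ) < 2)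
  refine ⟨k + d + 2, ?_⟩
  intro m hm
  refine ⟨∏ i ∈ Finset.range (m+1), ∏ j ∈ Finset.range (m+1), c i j, ?_, ?_, ?_⟩
  · exact Finset.prod_ne_zero_iff.2 fun i _ => Finset.prod_ne_zero_iff.2 fun j _ => hc0 i j
  · have hbd : ∀ σ : K →ₐ[ℚ] ℂ,
        ‖σ ((∏ i ∈ Finset.range (m+1), ∏ j ∈ Finset.range (m+1), c i j : 𝓞 K) : K)‖ ≤
          ((B ^ (3 * (d+1)^m)) ^ (m+1)) ^ (m+1) := by
      intro σ
      simp only [map_prod, norm_prod]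
      have h1 : ∀ i ∈ Finset.range (m+1), ∏ j ∈ Finset.range (m+1), ‖σ (c i j : K)‖ ≤
          (B ^ (3 * (d+1)^m)) ^ (m+1) := by
        intro i hi
        rw [Finset.mem_range] at hi
        calc _ ≤ ∏ j ∈ Finset.range (m+1), B ^ (3 * (d+1)^m) := by
              apply Finset.prod_le_prod
              · intros; positivity
              · intro j hj
                rw [Finset.mem_range] at hj
                exact hcb i j m (by omega) (by omega) σ
          _ = _ := by simp
      calc _ ≤ ∏ i ∈ Finset.range (m+1), (B ^ (3 * (d+1)^m)) ^ (m+1) := by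
              apply Finset.prod_le_prod
              · intros; positivity
              · exact h1
        _ = _ := by simp
    have h1 := aux_norm_bound K _ _ hbd
    rcases Nat.eq_zero_or_pos (Ideal.absNorm (Ideal.span
      {(∏ i ∈ Finset.range (m+1), ∏ j ∈ Finset.range (m+1), c i j : 𝓞 K)})) with h0 | h0
    · rw [h0]; simp
    have h2 := Real.log_le_log (by exact_mod_cast h0) h1
    refine h2.trans ?_
    rw [← pow_mul, ← pow_mul, ← pow_mul, Real.log_pow]
    push_cast
    have e1 : ((d:ℝ)+1) ^ m ≤ (2 ^ d) ^ m := by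
      apply pow_le_pow_left₀ (by positivity)
      have : d + 1 ≤ 2 ^ d := Nat.lt_two_pow_self
      exact_mod_cast this
    have e2 : ((m:ℝ)+1) ≤ 2 ^ m := by
      have : m + 1 ≤ 2 ^ m := Nat.lt_two_pow_self
      exact_mod_cast this
    have e3 : 3 * n * Real.log B ≤ (2 ^ k) ^ m :=
      hk.le.trans (le_self_pow₀ (one_le_pow₀ (by norm_num)) (by omega))
    have e4 : 0 ≤ Real.log B := Real.log_nonneg hB1
    calc _ = (3 * n * Real.log B) * ((d:ℝ)+1) ^ m * (((m:ℝ)+1) * ((m:ℝ)+1)) := by ring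
      _ ≤ (2 ^ k) ^ m * (2 ^ d) ^ m * (2 ^ m * 2 ^ m) := by gcongr
      _ = _ := by
        rw [← pow_mul, ← pow_mul, ← pow_add, ← pow_add, ← pow_add]
        congr 1
        ring
  · intro p hp hlen
    have : Finite (𝓞 K ⧸ p) := Ideal.finiteQuotientOfFreeOfNeBot p hp
    unfold orbitLenK at hlen
    set g : ℕ → Quotient (MulAction.orbitRel ((𝓞 K) ⧸ p)ˣ (Fin (N + 1) → (𝓞 K) ⧸ p)) :=
      fun n => Quotient.mk _ (fun i => Ideal.Quotient.mk p (((FmapK K Fp)^[n] α) i)) with hg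
    have hfin : (Set.range g).Finite := Set.toFinite _
    obtain ⟨i, hi, j, hj, hij, hgij⟩ : ∃ i ∈ Finset.range (m+1), ∃ j ∈ Finset.range (m+1),
        i ≠ j ∧ g i = g j := by
      apply Finset.exists_ne_map_eq_of_card_lt_of_maps_to (t := hfin.toFinset)
      · rw [← Set.ncard_eq_toFinset_card _ hfin, Finset.card_range]
        omega
      · intro a _
        simp
    wlog hlt : i < j generalizing i j
    · exact this j hj i hi hij.symm hgij.symm (by omega)
    have hmem : c i j ∈ p := by
      obtain ⟨a, b, hab⟩ := hcx i j hlt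
      rw [hab]
      have hrel := Quotient.exact hgij
      obtain ⟨u, hu⟩ := MulAction.orbitRel_apply.1 hrel
      have hu' : ∀ t, (u : 𝓞 K ⧸ p) * Ideal.Quotient.mk p (x j t) = Ideal.Quotient.mk p (x i t) :=
        fun t => congrFun hu t
      rw [← Ideal.Quotient.eq_zero_iff_mem, map_sub, map_mul, map_mul, ← hu' a, ← hu' b]
      ring
    apply Ideal.mem_of_dvd p _ hmem
    exact (Finset.dvd_prod_of_mem (fun j => c i j) hj).trans
      (Finset.dvd_prod_of_mem (fun i => ∏ j ∈ Finset.range (m+1), c i j) hi)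

lemma aux_S (K : Type) [Field K] [NumberField K] {N d : ℕ}
    (Fp : Fin (N + 1) → MvPolynomial (Fin (N + 1)) (𝓞 K))
    (hhom : ∀ i, (Fp i).IsHomogeneous d) (α : Fin (N + 1) → 𝓞 K)
    (horbit : ∀ m n : ℕ, m < n → ∃ i j : Fin (N + 1),
      ((FmapK K Fp)^[m] α) i * ((FmapK K Fp)^[n] α) j ≠
        ((FmapK K Fp)^[m] α) j * ((FmapK K Fp)^[n] α) i) :
    ∃ C : ℝ, 0 < C ∧ ∀ (m : ℕ) (T : Finset {p : Ideal (𝓞 K) // GoodIdeal K Fp α p}),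
      (∀ p ∈ T, orbitLenK K Fp α p.1 ≤ m) →
      ∑ p ∈ T, Real.log (Ideal.absNorm p.1) / (Ideal.absNorm p.1 : ℝ) ≤ C * m := by
  obtain ⟨c, hc⟩ := aux_D K Fp hhom α horbit
  refine ⟨c * (2 * Module.finrank ℤ (𝓞 K) * Real.log 4) + 1, ?_, ?_⟩
  · have : 0 ≤ Real.log 4 := Real.log_nonneg (by norm_num)
    positivity
  intro m T hT
  rcases Nat.eq_zero_or_pos m with rfl | hm
  · have : T = ∅ := by
      apply Finset.eq_empty_of_forall_notMem
      intro p hp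
      have h := hT p hp
      have : Finite (𝓞 K ⧸ p.1) := Ideal.finiteQuotientOfFreeOfNeBot p.1 p.2.2.1
      unfold orbitLenK at h
      rw [Nat.le_zero, Set.ncard_eq_zero (Set.toFinite _)] at h
      exact (Set.range_nonempty _).ne_empty h
    simp [this]
  · obtain ⟨D, hD, hlog, hmem⟩ := hc m hm
    have h := aux_C K (T.map (Function.Embedding.subtype _)) ?_ (c * m) D hD ?_ hlog
    · rw [Finset.sum_map] at h
      refine h.trans ?_
      push_cast
      have : (1:ℝ) ≤ m := by exact_mod_cast hm
      nlinarith
    · intro p hp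
      obtain ⟨q, hq, rfl⟩ := Finset.mem_map.1 hp
      exact ⟨q.2.1, q.2.2.1⟩
    · intro p hp
      obtain ⟨q, hq, rfl⟩ := Finset.mem_map.1 hp
      exact hmem _ q.2.2.1 (hT q hq)

theorem stmt5 (K : Type) [Field K] [NumberField K] (N d : ℕ) (hN : 1 ≤ N) (hd : 2 ≤ d)
    (Fp : Fin (N + 1) → MvPolynomial (Fin (N + 1)) (𝓞 K))
    (hhom : ∀ i, (Fp i).IsHomogeneous d)
    (hzero : ∀ x : Fin (N + 1) → AlgebraicClosure K,
      (∀ i, MvPolynomial.aeval x ((Fp i).map (algebraMap (𝓞 K) K)) = 0) → x = 0)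
    (α : Fin (N + 1) → 𝓞 K) (hα : α ≠ 0)
    (horbit : ∀ m n : ℕ, m < n → ∃ i j : Fin (N + 1),
      ((FmapK K Fp)^[m] α) i * ((FmapK K Fp)^[n] α) j ≠
        ((FmapK K Fp)^[m] α) j * ((FmapK K Fp)^[n] α) i)
    (l : ℝ) (hl : 1 ≤ l) :
    ∃ C : ℝ, 0 < C ∧ ∀ s : ℝ, 0 < s →
      Summable (fun p : {p : Ideal (𝓞 K) // GoodIdeal K Fp α p} =>
        Real.log (Ideal.absNorm p.1) /
          ((Ideal.absNorm p.1 : ℝ) * Real.exp (s * (orbitLenK K Fp α p.1 : ℝ) ^ l))) ∧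
      (∑' p : {p : Ideal (𝓞 K) // GoodIdeal K Fp α p},
          Real.log (Ideal.absNorm p.1) /
            ((Ideal.absNorm p.1 : ℝ) * Real.exp (s * (orbitLenK K Fp α p.1 : ℝ) ^ l)))
        ≤ C * s ^ (-1 / l) := by
  obtain ⟨C, hC, hS⟩ := aux_S K Fp hhom α horbit
  have hl0 : 0 < l := by linarith
  have hG : 0 < Real.Gamma (1 / l + 1) := Real.Gamma_pos_of_pos (by positivity)
  refine ⟨C * Real.Gamma (1 / l + 1), by positivity, ?_⟩
  intro s hs
  have hnn : 0 ≤ (fun p : {p : Ideal (𝓞 K) // GoodIdeal K Fp α p} =>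
        Real.log (Ideal.absNorm p.1) /
          ((Ideal.absNorm p.1 : ℝ) * Real.exp (s * (orbitLenK K Fp α p.1 : ℝ) ^ l))) := by
    intro p
    have := Real.log_natCast_nonneg (Ideal.absNorm p.1)
    simp only [Pi.zero_apply]
    positivity
  have hle : ∀ T : Finset {p : Ideal (𝓞 K) // GoodIdeal K Fp α p}, ∑ p ∈ T,
        Real.log (Ideal.absNorm p.1) /
          ((Ideal.absNorm p.1 : ℝ) * Real.exp (s * (orbitLenK K Fp α p.1 : ℝ) ^ l)) ≤
        C * Real.Gamma (1 / l + 1) * s ^ (-1 / l) := by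
    intro T
    obtain ⟨M, hM⟩ := aux_max T (fun p => orbitLenK K Fp α p.1)
    have h1 := aux_abel T (fun p => Real.log (Ideal.absNorm p.1) / (Ideal.absNorm p.1 : ℝ))
      (fun p => orbitLenK K Fp α p.1) C (fun n => Real.exp (-s * (n : ℝ) ^ l)) ?_
      (fun n => (Real.exp_pos _).le) ?_ M hM
    · have h2 := h1.trans (mul_le_mul_of_nonneg_left (aux_int l s hl hs _) hC.le)
      have h3 : C * Real.Gamma (1 / l + 1) * s ^ (-1 / l) =
        C * (s ^ (-1 / l) * Real.Gamma (1 / l + 1)) := by ring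
      rw [h3]
      refine le_trans (le_of_eq ?_) h2
      apply Finset.sum_congr rfl
      intro p _
      rw [neg_mul, Real.exp_neg, div_mul_eq_div_div, div_eq_mul_inv (_ / _)]
    · intro a b hab
      apply Real.exp_le_exp.2
      have : (a:ℝ) ^ l ≤ (b:ℝ) ^ l :=
        Real.rpow_le_rpow (by positivity) (by exact_mod_cast hab) hl0.le
      nlinarith
    · intro k
      exact hS k _ (fun p hp => (Finset.mem_filter.1 hp).2)
  exact ⟨summable_of_sum_le hnn hle, Real.tsum_le_of_sum_le hnn hle⟩
end
end

section
/- There exist a constant C > 0, a finite set S of nonzero prime ideals of 𝓞_K containing all primes that are not good, and for each integer m ≥ 1 a nonzero integral ideal 𝔇(m) of 𝓞_K, such that: (i) for every nonzero prime ideal 𝔭 ∉ S, one has m_𝔭(φ,P) ≤ m if and only if 𝔭 divides 𝔇(m); and (ii) for every m ≥ 1, log N(𝔇(m)) ≤ C·m·dᵐ, where N denotes the absolute norm. (In particular log log N(𝔇(m)) ≤ (log d)·m + C'·(1 + log m) for a suitable constant C'.) -/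
open MvPolynomial NumberField Filter Topology

noncomputable section

section
attribute [local instance] MvPolynomial.algebraMvPolynomial

lemma aux_null (K : Type) [Field K] [NumberField K] {N : ℕ}
    (Fp : Fin (N + 1) → MvPolynomial (Fin (N + 1)) (𝓞 K))
    (hzero : ∀ x : Fin (N + 1) → AlgebraicClosure K,
      (∀ i, MvPolynomial.aeval x ((Fp i).map (algebraMap (𝓞 K) K)) = 0) → x = 0) :
    ∃ δ : 𝓞 K, δ ≠ 0 ∧ ∀ k, ∃ e : ℕ,
      X k ^ e * C δ ∈ Ideal.span (Set.range Fp) := by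
  have key : ∀ k, ∃ e : ℕ, ∃ δ : 𝓞 K, δ ≠ 0 ∧
      X k ^ e * C δ ∈ Ideal.span (Set.range Fp) := by
    intro k
    set J := Ideal.span (Set.range Fp)
    have h1 : (X k : MvPolynomial (Fin (N + 1)) K) ∈
        (J.map (algebraMap (MvPolynomial (Fin (N + 1)) (𝓞 K))
          (MvPolynomial (Fin (N + 1)) K))).radical := by
      rw [← vanishingIdeal_zeroLocus_eq_radical (K := AlgebraicClosure K)]
      intro x hx
      have : x = 0 := by
        apply hzero
        intro i
        exact hx _ (Ideal.mem_map_of_mem _ (Ideal.subset_span ⟨i, rfl⟩))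
      simp [this]
    obtain ⟨e, he⟩ := h1
    rw [IsLocalization.mem_map_algebraMap_iff
      ((nonZeroDivisors (𝓞 K)).map (C (σ := Fin (N + 1))))] at he
    obtain ⟨⟨⟨j, hj⟩, ⟨s, hs⟩⟩, hjs⟩ := he
    obtain ⟨δ, hδ, rfl⟩ := hs
    refine ⟨e, δ, nonZeroDivisors.ne_zero hδ, ?_⟩
    have : X k ^ e * C δ = j := by
      apply MvPolynomial.map_injective (algebraMap (𝓞 K) K) (RingOfIntegers.coe_injective)
      have hjs' : X k ^ e * MvPolynomial.map (algebraMap (𝓞 K) K) (C δ) =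
          MvPolynomial.map (algebraMap (𝓞 K) K) j := hjs
      rw [map_mul, map_pow, map_X]
      exact hjs'
    rw [this]; exact hj
  choose e δ hδ h using key
  refine ⟨∏ k, δ k, Finset.prod_ne_zero_iff.2 fun k _ => hδ k, fun k => ⟨e k, ?_⟩⟩
  rw [← Finset.mul_prod_erase _ _ (Finset.mem_univ k), C_mul, ← mul_assoc]
  exact Ideal.mul_mem_right _ _ (h k)

end

lemma aux_zero {A R σ : Type*} [CommRing A] [CommRing R] [IsDomain R]
    (Fp : σ → MvPolynomial σ A) (δ : A)
    (h : ∀ k, ∃ e : ℕ, X k ^ e * C δ ∈ Ideal.span (Set.range Fp))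
    (f : A →+* R) (hf : f δ ≠ 0) (x : σ → R) (hx : ∀ i, eval₂ f x (Fp i) = 0) : x = 0 := by
  funext k
  obtain ⟨e, he⟩ := h k
  have hle : Ideal.span (Set.range Fp) ≤ RingHom.ker (eval₂Hom f x) := by
    rw [Ideal.span_le]
    rintro _ ⟨i, rfl⟩
    exact hx i
  have := hle he
  rw [RingHom.mem_ker] at this
  simp at this
  rcases this with h | h
  · exact h.1
  · exact absurd h hf

lemma aux_hom {R σ : Type*} [CommRing R] [Fintype σ] (d : ℕ) (f : MvPolynomial σ R)
    (hf : f.IsHomogeneous d) (u : R) (x : σ → R) :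
    eval (fun i => u * x i) f = u ^ d * eval x f := by
  rw [eval_eq', eval_eq', Finset.mul_sum]
  refine Finset.sum_congr rfl fun m hm => ?_
  have := hf (mem_support_iff.1 hm)
  rw [Finsupp.weight_apply, Finsupp.sum_fintype _ _ (by simp)] at this
  simp only [Pi.one_apply, smul_eq_mul, mul_one] at this
  simp_rw [mul_pow]
  rw [Finset.prod_mul_distrib, Finset.prod_pow_eq_pow_sum, this]
  ring

lemma aux_orbit {Q : Type*} (x : ℕ → Q) (hstep : ∀ i j, x i = x j → x (i + 1) = x (j + 1))
    (hfin : (Set.range x).Finite) (m : ℕ) :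
    (Set.range x).ncard ≤ m ↔ ∃ j ∈ Finset.range (m + 1), ∃ i ∈ Finset.range j, x i = x j := by
  constructor
  · intro h
    by_contra! hc
    have hinj : Set.InjOn x (Finset.range (m + 1) : Set ℕ) := by
      intro a ha b hb hab
      by_contra hne
      rcases lt_or_gt_of_ne hne with hlt | hlt
      · exact hc b (by simpa using hb) a (by simpa using hlt) hab
      · exact hc a (by simpa using ha) b (by simpa using hlt) hab.symm
    have h1 := hinj.ncard_image
    rw [Set.ncard_coe_finset, Finset.card_range] at h1
    have h2 := Set.ncard_le_ncard (Set.image_subset_range x (Finset.range (m + 1) : Set ℕ)) hfin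
    omega
  · rintro ⟨j, hj, i, hi, hij⟩
    simp only [Finset.mem_range] at hj hi
    have hs : ∀ t, x (i + t) = x (j + t) := by
      intro t
      induction t with
      | zero => simpa using hij
      | succ t ih => exact hstep _ _ ih
    have hsub : Set.range x ⊆ x '' (Finset.range j : Set ℕ) := by
      rintro _ ⟨n, rfl⟩
      induction n using Nat.strong_induction_on with
      | _ n ih =>
        by_cases hn : n < j
        · exact ⟨n, by simpa using hn, rfl⟩
        · have := hs (n - j)
          rw [show j + (n - j) = n by omega] at this
          rw [← this]
          exact ih _ (by omega)
    have h1 := Set.ncard_le_ncard hsub (Set.Finite.image _ (Finset.finite_toSet _))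
    have h2 := Set.ncard_image_le (f := x) (Finset.finite_toSet (Finset.range j))
    rw [Set.ncard_coe_finset, Finset.card_range] at h2
    omega

lemma aux_prop {R σ : Type*} [CommRing R] (hR : IsField R) (x y : σ → R) (hx : x ≠ 0)
    (hy : y ≠ 0) :
    (∃ u : Rˣ, u • y = x) ↔ ∀ a b, x a * y b - x b * y a = 0 := by
  constructor
  · rintro ⟨u, rfl⟩ a b
    simp only [Pi.smul_apply, Units.smul_def, smul_eq_mul]
    ring
  · intro h
    obtain ⟨b, hb⟩ := Function.ne_iff.1 hy
    obtain ⟨a, ha⟩ := Function.ne_iff.1 hx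
    simp only [Pi.zero_apply] at ha hb
    have hb' : IsUnit (y b) := by
      obtain ⟨z, hz⟩ := hR.mul_inv_cancel hb
      exact IsUnit.of_mul_eq_one z hz
    have hxb : x b ≠ 0 := by
      intro h0
      have := h a b
      rw [h0, zero_mul, sub_zero] at this
      exact ha (hb'.mul_left_eq_zero.1 this)
    have hx' : IsUnit (x b) := by
      obtain ⟨z, hz⟩ := hR.mul_inv_cancel hxb
      exact IsUnit.of_mul_eq_one z hz
    obtain ⟨v, hv⟩ := hb'
    obtain ⟨w, hw⟩ := hx'
    refine ⟨w * v⁻¹, ?_⟩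
    funext c
    have := h c b
    rw [← hv, ← hw] at this
    have h2 : x c = (w : R) * y c * ((v⁻¹ : Rˣ) : R) := by
      rw [Units.eq_mul_inv_iff_mul_eq]; linear_combination this
    rw [h2]
    simp only [Pi.smul_apply, Units.smul_def, smul_eq_mul, Units.val_mul]
    ring

lemma aux_bound (K : Type) [Field K] [NumberField K] {N d : ℕ} (hd : 2 ≤ d)
    (Fp : Fin (N + 1) → MvPolynomial (Fin (N + 1)) (𝓞 K))
    (hhom : ∀ i, (Fp i).IsHomogeneous d) (α : Fin (N + 1) → 𝓞 K) :
    ∃ A : ℝ, 2 ≤ A ∧ ∀ (σ : K →ₐ[ℚ] ℂ) (n : ℕ) (i),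
      ‖σ (((FmapK K Fp)^[n] α) i : 𝓞 K)‖ ≤ A ^ (2 * d ^ n - 1) := by
  set c : ℝ := ∑ σ : K →ₐ[ℚ] ℂ, ∑ i, ∑ m ∈ (Fp i).support, ‖σ (((Fp i).coeff m : 𝓞 K) : K)‖
  set a : ℝ := ∑ σ : K →ₐ[ℚ] ℂ, ∑ i, ‖σ (α i)‖
  have hc : 0 ≤ c := by positivity
  have ha : 0 ≤ a := by positivity
  have hci : ∀ (σ : K →ₐ[ℚ] ℂ) i, ∑ m ∈ (Fp i).support, ‖σ (((Fp i).coeff m : 𝓞 K) : K)‖ ≤ c := by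
    intro σ i
    refine le_trans ?_ (Finset.single_le_sum
      (f := fun σ : K →ₐ[ℚ] ℂ => ∑ i, ∑ m ∈ (Fp i).support, ‖σ (((Fp i).coeff m : 𝓞 K) : K)‖)
      (fun _ _ => by positivity) (Finset.mem_univ σ))
    exact Finset.single_le_sum (f := fun i => ∑ m ∈ (Fp i).support, ‖σ (((Fp i).coeff m : 𝓞 K) : K)‖)
      (fun _ _ => by positivity) (Finset.mem_univ i)
  have hai : ∀ (σ : K →ₐ[ℚ] ℂ) i, ‖σ (α i)‖ ≤ a := by
    intro σ i
    refine le_trans ?_ (Finset.single_le_sum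
      (f := fun σ : K →ₐ[ℚ] ℂ => ∑ i, ‖σ (α i)‖)
      (fun _ _ => by positivity) (Finset.mem_univ σ))
    exact Finset.single_le_sum (f := fun i => ‖σ (α i)‖)
      (fun _ _ => by positivity) (Finset.mem_univ i)
  refine ⟨2 + c + a, by linarith, fun σ n => ?_⟩
  induction n with
  | zero => intro i; simpa using (hai σ i).trans (by linarith)
  | succ n ih =>
    intro i
    rw [Function.iterate_succ_apply']
    set b := (FmapK K Fp)^[n] α
    set A := 2 + c + a
    have hA : 1 ≤ A := by simp only [A]; linarith
    have h1 : σ ((FmapK K Fp b i : 𝓞 K) : K) = ∑ m ∈ (Fp i).support,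
        σ (((Fp i).coeff m : 𝓞 K) : K) * ∏ j, σ (b j) ^ m j := by
      simp only [FmapK, eval_eq']
      simp
    rw [h1]
    have h2 : ∀ m ∈ (Fp i).support, ‖σ (((Fp i).coeff m : 𝓞 K) : K) * ∏ j, σ (b j) ^ m j‖ ≤
        ‖σ (((Fp i).coeff m : 𝓞 K) : K)‖ * A ^ ((2 * d ^ n - 1) * d) := by
      intro m hm
      rw [norm_mul, norm_prod]
      gcongr
      have := hhom i (mem_support_iff.1 hm)
      rw [Finsupp.weight_apply, Finsupp.sum_fintype _ _ (by simp)] at this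
      simp only [Pi.one_apply, smul_eq_mul, mul_one] at this
      rw [pow_mul]
      refine le_of_le_of_eq ?_ (congrArg (fun t => (A ^ (2 * d ^ n - 1)) ^ t) this)
      rw [← Finset.prod_pow_eq_pow_sum]
      refine Finset.prod_le_prod (fun _ _ => by positivity) fun j _ => ?_
      rw [norm_pow]
      gcongr
      exact ih j
    calc _ ≤ ∑ m ∈ (Fp i).support, ‖σ (((Fp i).coeff m : 𝓞 K) : K)‖ * A ^ ((2 * d ^ n - 1) * d) :=
          (norm_sum_le _ _).trans (Finset.sum_le_sum h2)
      _ = (∑ m ∈ (Fp i).support, ‖σ (((Fp i).coeff m : 𝓞 K) : K)‖) * A ^ ((2 * d ^ n - 1) * d) := by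
          rw [Finset.sum_mul]
      _ ≤ A * A ^ ((2 * d ^ n - 1) * d) := by
          gcongr
          exact (hci σ i).trans (by simp only [A]; linarith)
      _ = A ^ ((2 * d ^ n - 1) * d + 1) := by rw [pow_succ']
      _ ≤ A ^ (2 * d ^ (n + 1) - 1) := by
          apply pow_le_pow_right₀ hA
          have : 1 ≤ d ^ n := Nat.one_le_pow _ _ (by omega)
          obtain ⟨t, ht⟩ : ∃ t, d ^ n = t + 1 := ⟨d ^ n - 1, by omega⟩
          rw [pow_succ, ht, show 2 * (t + 1) - 1 = 2 * t + 1 by omega]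
          have : (2 * t + 1) * d + d = 2 * ((t + 1) * d) := by ring
          omega

lemma aux_norm (K : Type) [Field K] [NumberField K] (I : Ideal (𝓞 K)) (z : 𝓞 K) (hz : z ≠ 0)
    (hzI : z ∈ I) (B : ℝ) (hB : ∀ σ : K →ₐ[ℚ] ℂ, ‖σ z‖ ≤ B) :
    (Ideal.absNorm I : ℝ) ≤ B ^ Module.finrank ℚ K := by
  have h1 : Ideal.absNorm I ≤ Ideal.absNorm (Ideal.span {z}) := by
    apply Nat.le_of_dvd
    · rw [Nat.pos_iff_ne_zero, Ne, Ideal.absNorm_eq_zero_iff]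
      simpa using hz
    · exact Ideal.absNorm_dvd_absNorm_of_le ((Ideal.span_singleton_le_iff_mem _).2 hzI)
  have h2 : ((Ideal.absNorm (Ideal.span {z}) : ℕ) : ℝ) = ∏ σ : K →ₐ[ℚ] ℂ, ‖σ z‖ := by
    rw [Ideal.absNorm_span_singleton, ← norm_prod, ← Algebra.norm_eq_prod_embeddings,
      ← Algebra.coe_norm_int]
    simp [Nat.cast_natAbs]
  calc (Ideal.absNorm I : ℝ) ≤ (Ideal.absNorm (Ideal.span {z}) : ℕ) := by exact_mod_cast h1
    _ ≤ ∏ σ : K →ₐ[ℚ] ℂ, B := by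
      rw [h2]; exact Finset.prod_le_prod (fun _ _ => norm_nonneg _) fun σ _ => hB σ
    _ = _ := by
      rw [Finset.prod_const, Finset.card_univ, AlgHom.card]

/-- The ideal of minors of two vectors. -/
def minorIdeal {R σ : Type*} [CommRing R] (x y : σ → R) : Ideal R :=
  Ideal.span (Set.range fun q : σ × σ => x q.1 * y q.2 - x q.2 * y q.1)

lemma aux_arith (d m : ℕ) (hd : 2 ≤ d) :
    ∑ j ∈ Finset.range (m + 1), (j : ℝ) * (d : ℝ) ^ j ≤ 2 * m * (d : ℝ) ^ m := by
  have hd' : (2 : ℝ) ≤ d := by exact_mod_cast hd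
  induction m with
  | zero => simp
  | succ m ih =>
    rw [Finset.sum_range_succ]
    have h0 : (0 : ℝ) ≤ (d : ℝ) ^ m := by positivity
    have hm : (0 : ℝ) ≤ m := by positivity
    have h1 : 2 * (m * (d : ℝ) ^ m) ≤ d * (m * (d : ℝ) ^ m) := by gcongr
    have h2 : (0 : ℝ) ≤ d * (d : ℝ) ^ m := by positivity
    push_cast
    rw [pow_succ']
    nlinarith

lemma aux_loglog (d m : ℕ) (hd : 2 ≤ d) (hm : 1 ≤ m) (C L : ℝ) (hC : 0 < C) (hL0 : 0 ≤ L)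
    (hL : L ≤ C * m * (d : ℝ) ^ m) :
    Real.log L ≤ Real.log d * m + (|Real.log C| + 1) * (1 + Real.log m) := by
  have hd' : (1 : ℝ) ≤ d := by exact_mod_cast (by omega : 1 ≤ d)
  have hm' : (1 : ℝ) ≤ m := by exact_mod_cast hm
  have l1 := Real.log_nonneg hd'
  have l2 := Real.log_nonneg hm'
  have l3 := abs_nonneg (Real.log C)
  have l4 := le_abs_self (Real.log C)
  have l5 := mul_nonneg l3 l2
  have l6 : 0 ≤ Real.log d * m := by positivity
  rcases hL0.eq_or_lt with h | h
  · rw [← h, Real.log_zero]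
    nlinarith
  · have := Real.log_le_log h hL
    rw [Real.log_mul (by positivity) (by positivity), Real.log_mul (by positivity) (by positivity),
      Real.log_pow] at this
    nlinarith

lemma aux_fmap (K : Type) [Field K] [NumberField K] {N : ℕ}
    (Fp : Fin (N + 1) → MvPolynomial (Fin (N + 1)) (𝓞 K)) (p : Ideal (𝓞 K))
    (b : Fin (N + 1) → 𝓞 K) (i) :
    Ideal.Quotient.mk p (FmapK K Fp b i) =
      eval (fun j => Ideal.Quotient.mk p (b j)) ((Fp i).map (Ideal.Quotient.mk p)) := by
  rw [eval_map]
  simp only [FmapK]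
  rw [← eval₂_id, hom_eval₂]
  rfl

theorem stmt11 (K : Type) [Field K] [NumberField K] (N d : ℕ) (hN : 1 ≤ N) (hd : 2 ≤ d)
    (Fp : Fin (N + 1) → MvPolynomial (Fin (N + 1)) (𝓞 K))
    (hhom : ∀ i, (Fp i).IsHomogeneous d)
    (hzero : ∀ x : Fin (N + 1) → AlgebraicClosure K,
      (∀ i, MvPolynomial.aeval x ((Fp i).map (algebraMap (𝓞 K) K)) = 0) → x = 0)
    (α : Fin (N + 1) → 𝓞 K) (hα : α ≠ 0)
    (horbit : ∀ m n : ℕ, m < n → ∃ i j : Fin (N + 1),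
      ((FmapK K Fp)^[m] α) i * ((FmapK K Fp)^[n] α) j ≠
        ((FmapK K Fp)^[m] α) j * ((FmapK K Fp)^[n] α) i) :
    ∃ C : ℝ, 0 < C ∧ ∃ S : Finset (Ideal (𝓞 K)),
      (∀ p : Ideal (𝓞 K), p.IsPrime → p ≠ ⊥ → ¬ GoodIdeal K Fp α p → p ∈ S) ∧
      ∃ D : ℕ → Ideal (𝓞 K),
        (∀ m : ℕ, 1 ≤ m →
          D m ≠ ⊥ ∧
          (∀ p : Ideal (𝓞 K), p.IsPrime → p ≠ ⊥ → p ∉ S →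
            (orbitLenK K Fp α p ≤ m ↔ p ∣ D m)) ∧
          Real.log (Ideal.absNorm (D m)) ≤ C * m * (d : ℝ) ^ m) ∧
        ∃ C' : ℝ, 0 < C' ∧ ∀ m : ℕ, 1 ≤ m →
          Real.log (Real.log (Ideal.absNorm (D m))) ≤
            Real.log d * m + C' * (1 + Real.log m) := by
  classical
  obtain ⟨δ, hδ, hnull⟩ := aux_null K Fp hzero
  obtain ⟨A, hA2, hA⟩ := aux_bound K hd Fp hhom α
  obtain ⟨k₀, hk₀⟩ := Function.ne_iff.1 hα
  simp only [Pi.zero_apply] at hk₀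
  set v : ℕ → Fin (N + 1) → 𝓞 K := fun n => (FmapK K Fp)^[n] α with hv
  have hvsucc : ∀ n, v (n + 1) = FmapK K Fp (v n) := fun n => by
    simp only [hv, Function.iterate_succ_apply']
  set r := Module.finrank ℚ K
  have hr : (0 : ℝ) < r := by exact_mod_cast Module.finrank_pos
  have hlogA : 0 < Real.log A := Real.log_pos (by linarith)
  set C₀ : ℝ := 5 * r * Real.log A with hC₀
  have hC₀pos : 0 < C₀ := by positivity
  have hfinS : {p : Ideal (𝓞 K) | p.IsPrime ∧ p ≠ ⊥ ∧ δ * α k₀ ∈ p}.Finite := by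
    have h := Ideal.finite_factors (I := Ideal.span {δ * α k₀})
      (by simpa using ⟨hδ, hk₀⟩)
    refine (h.image fun w => w.asIdeal).subset ?_
    rintro p ⟨hp, hp0, hmem⟩
    refine ⟨⟨p, hp, hp0⟩, ?_, rfl⟩
    simpa [Ideal.dvd_span_singleton] using hmem
  have hout : ∀ p : Ideal (𝓞 K), p.IsPrime → p ≠ ⊥ → p ∉ hfinS.toFinset → δ ∉ p ∧ α k₀ ∉ p := by
    intro p hp hp0 hpS
    simp only [Set.Finite.mem_toFinset, Set.mem_setOf_eq, not_and] at hpS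
    have := hpS hp hp0
    exact ⟨fun h => this (Ideal.mul_mem_right _ _ h), fun h => this (Ideal.mul_mem_left _ _ h)⟩
  refine ⟨2 * C₀, by positivity, hfinS.toFinset, ?_,
    fun m => ∏ j ∈ Finset.range (m + 1), ∏ i ∈ Finset.range j, minorIdeal (v i) (v j), ?_⟩
  · intro p hp hp0 hbad
    by_contra hpS
    obtain ⟨h1, h2⟩ := hout p hp hp0 hpS
    apply hbad
    have hm : p.IsMaximal := hp.isMaximal hp0
    refine ⟨hp, hp0, fun hle => h2 (hle (Ideal.subset_span ⟨k₀, rfl⟩)), hm, ?_⟩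
    letI : Field ((𝓞 K) ⧸ p) := Ideal.Quotient.field p
    intro x hx
    refine aux_zero Fp δ hnull
      ((algebraMap ((𝓞 K) ⧸ p) (AlgebraicClosure ((𝓞 K) ⧸ p))).comp (Ideal.Quotient.mk p)) ?_ x ?_
    · simp only [RingHom.comp_apply]
      rw [Ne, FaithfulSMul.algebraMap_eq_zero_iff]
      rwa [Ideal.Quotient.eq_zero_iff_mem]
    · intro i
      have := hx i
      rwa [aeval_def, eval₂_map] at this
  have hminor : ∀ i j, i < j → ∃ z ∈ minorIdeal (v i) (v j), z ≠ 0 ∧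
      ∀ σ : K →ₐ[ℚ] ℂ, ‖σ z‖ ≤ A ^ (5 * d ^ j) := by
    intro i j hij
    obtain ⟨a, b, hab⟩ := horbit i j hij
    refine ⟨v i a * v j b - v i b * v j a, Ideal.subset_span ⟨(a, b), rfl⟩, sub_ne_zero.2 hab, ?_⟩
    intro σ
    have hle : ∀ a b, ‖σ (v i a)‖ * ‖σ (v j b)‖ ≤ A ^ (2 * d ^ j) * A ^ (2 * d ^ j) := by
      intro a b
      have hA1 : 1 ≤ A := by linarith
      have hdij : d ^ i ≤ d ^ j := Nat.pow_le_pow_right (by omega) hij.le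
      gcongr
      · exact (hA σ i a).trans (pow_le_pow_right₀ hA1 (by omega))
      · exact (hA σ j b).trans (pow_le_pow_right₀ hA1 (by omega))
    have h3 : (2 : ℝ) ≤ A ^ (d ^ j) := by
      refine hA2.trans ?_
      exact le_self_pow₀ (by linarith) (by positivity)
    calc ‖σ ((v i a * v j b - v i b * v j a : 𝓞 K) : K)‖
        = ‖σ (v i a) * σ (v j b) - σ (v i b) * σ (v j a)‖ := by simp
      _ ≤ ‖σ (v i a)‖ * ‖σ (v j b)‖ + ‖σ (v i b)‖ * ‖σ (v j a)‖ := by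
          refine (norm_sub_le _ _).trans ?_
          simp
      _ ≤ 2 * (A ^ (2 * d ^ j) * A ^ (2 * d ^ j)) := by linarith [hle a b, hle b a]
      _ ≤ A ^ (d ^ j) * (A ^ (2 * d ^ j) * A ^ (2 * d ^ j)) := by gcongr
      _ = A ^ (5 * d ^ j) := by ring
  have hne : ∀ i j, i < j → minorIdeal (v i) (v j) ≠ ⊥ := by
    intro i j hij h
    obtain ⟨z, hz, hz0, -⟩ := hminor i j hij
    rw [h] at hz
    exact hz0 (by simpa using hz)
  have hlog : ∀ i j, i < j → Real.log (Ideal.absNorm (minorIdeal (v i) (v j))) ≤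
      C₀ * (d : ℝ) ^ j := by
    intro i j hij
    obtain ⟨z, hz, hz0, hzb⟩ := hminor i j hij
    have h1 := aux_norm K _ z hz0 hz _ hzb
    have h0 : (0 : ℝ) < Ideal.absNorm (minorIdeal (v i) (v j)) := by
      have : Ideal.absNorm (minorIdeal (v i) (v j)) ≠ 0 := by
        rw [Ne, Ideal.absNorm_eq_zero_iff]; exact hne i j hij
      exact_mod_cast Nat.pos_of_ne_zero this
    refine (Real.log_le_log h0 h1).trans (le_of_eq ?_)
    rw [Real.log_pow, Real.log_pow, hC₀]
    push_cast
    ring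
  have hbound : ∀ m : ℕ, Real.log (Ideal.absNorm (∏ j ∈ Finset.range (m + 1),
      ∏ i ∈ Finset.range j, minorIdeal (v i) (v j))) ≤ 2 * C₀ * m * (d : ℝ) ^ m := by
    intro m
    have hnz : ∀ j, ∀ i ∈ Finset.range j,
        ((Ideal.absNorm (minorIdeal (v i) (v j)) : ℕ) : ℝ) ≠ 0 := by
      intro j i hi
      rw [Nat.cast_ne_zero, Ne, Ideal.absNorm_eq_zero_iff]
      exact hne i j (Finset.mem_range.1 hi)
    rw [map_prod]
    simp_rw [map_prod]
    push_cast
    rw [Real.log_prod fun j _ => Finset.prod_ne_zero_iff.2 (hnz j)]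
    calc _ ≤ ∑ j ∈ Finset.range (m + 1), C₀ * ((j : ℝ) * (d : ℝ) ^ j) := by
          refine Finset.sum_le_sum fun j _ => ?_
          rw [Real.log_prod (hnz j)]
          refine (Finset.sum_le_sum fun i hi => hlog i j (Finset.mem_range.1 hi)).trans ?_
          rw [Finset.sum_const, Finset.card_range, nsmul_eq_mul]
          exact le_of_eq (by ring)
      _ = C₀ * ∑ j ∈ Finset.range (m + 1), (j : ℝ) * (d : ℝ) ^ j := by rw [Finset.mul_sum]
      _ ≤ C₀ * (2 * m * (d : ℝ) ^ m) := by gcongr; exact aux_arith d m hd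
      _ = _ := by ring
  refine ⟨fun m hm => ⟨?_, ?_, hbound m⟩, |Real.log (2 * C₀)| + 1, by positivity, fun m hm => ?_⟩
  · rw [← Ideal.zero_eq_bot]
    exact Finset.prod_ne_zero_iff.2 fun j _ => Finset.prod_ne_zero_iff.2 fun i hi =>
      hne i j (Finset.mem_range.1 hi)
  · intro p hp hp0 hpS
    obtain ⟨h1, h2⟩ := hout p hp hp0 hpS
    have hmax : p.IsMaximal := hp.isMaximal hp0
    have hfield : IsField ((𝓞 K) ⧸ p) := (Ideal.Quotient.maximal_ideal_iff_isField_quotient p).1 hmax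
    have hfinQ : Finite ((𝓞 K) ⧸ p) := p.finiteQuotientOfFreeOfNeBot hp0
    set w : ℕ → Fin (N + 1) → (𝓞 K) ⧸ p := fun n i => Ideal.Quotient.mk p (v n i) with hw
    have hwsucc : ∀ n i, w (n + 1) i = eval (w n) ((Fp i).map (Ideal.Quotient.mk p)) := by
      intro n i
      simp only [hw, hvsucc]
      exact aux_fmap K Fp p (v n) i
    have hw0 : ∀ n, w n ≠ 0 := by
      intro n
      induction n with
      | zero =>
        intro h
        exact h2 (Ideal.Quotient.eq_zero_iff_mem.1 (congrFun h k₀))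
      | succ n ih =>
        intro h
        apply ih
        refine aux_zero Fp δ hnull (Ideal.Quotient.mk p) ?_ (w n) ?_
        · rwa [Ne, Ideal.Quotient.eq_zero_iff_mem]
        · intro i
          rw [← eval_map, ← hwsucc, h]; rfl
    have hrel : ∀ i j, (Quotient.mk (MulAction.orbitRel ((𝓞 K) ⧸ p)ˣ
        (Fin (N + 1) → (𝓞 K) ⧸ p)) (w i) = Quotient.mk _ (w j)) ↔
        ∃ u : ((𝓞 K) ⧸ p)ˣ, u • w j = w i := by
      intro i j
      rw [Quotient.eq]
      rfl
    rw [orbitLenK]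
    rw [aux_orbit (fun n => Quotient.mk (MulAction.orbitRel ((𝓞 K) ⧸ p)ˣ
        (Fin (N + 1) → (𝓞 K) ⧸ p)) (w n)) ?_ ?_ m]
    · rw [Ideal.dvd_iff_le, hp.prod_le]
      refine exists_congr fun j => and_congr_right fun _ => ?_
      rw [hp.prod_le]
      refine exists_congr fun i => and_congr_right fun _ => ?_
      rw [hrel, aux_prop hfield _ _ (hw0 i) (hw0 j), minorIdeal, Ideal.span_le]
      constructor
      · rintro h _ ⟨⟨a, b⟩, rfl⟩
        have := h a b
        simp only [hw, ← map_mul, ← map_sub] at this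
        exact Ideal.Quotient.eq_zero_iff_mem.1 this
      · intro h a b
        simp only [hw, ← map_mul, ← map_sub]
        exact Ideal.Quotient.eq_zero_iff_mem.2 (h ⟨(a, b), rfl⟩)
    · intro i j hij
      simp only [hrel] at hij ⊢
      obtain ⟨u, hu⟩ := hij
      refine ⟨u ^ d, ?_⟩
      funext k
      rw [hwsucc, ← hu, Pi.smul_apply, hwsucc]
      have := aux_hom d _ ((hhom k).map (Ideal.Quotient.mk p)) (u : (𝓞 K) ⧸ p) (w j)
      rw [Units.smul_def, Units.val_pow_eq_pow_val, smul_eq_mul, ← this]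
      rfl
    · exact Set.toFinite _
  · refine aux_loglog d m hd hm (2 * C₀) _ (by positivity) (Real.log_natCast_nonneg _) (hbound m)
end
end
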